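/- arXiv:2206.09914 — 6 statements merged into one kernel-verified Lean document; each statement's English description precedes it below -/
import Mathlib

section
/- Let Θ ⊆ ℝ^d be a finite nonempty set, W a symmetric real d×d matrix, b ∈ ℝ^d, U(θ) = θᵀWθ + bᵀθ, and α > 0. Define the DLP kernel q_α(θ'|θ) = exp((1/2)⟨∇U(θ), θ'−θ⟩ − ‖θ'−θ‖₂²/(2α)) / Z_α(θ) with Z_α(θ) = Σ_{x∈Θ} exp((1/2)⟨∇U(θ), x−θ⟩ − ‖x−θ‖₂²/(2α)), and define π_α(θ) = Z_α(θ) e^{U(θ)} / Σ_{x∈Θ} Z_α(x) e^{U(x)}. Then the detailed balance condition π_α(θ) q_α(θ'|θ) = π_α(θ') q_α(θ|θ') holds for all θ, θ' ∈ Θ; consequently π_α is a stationary distribution of the Markov chain with transition kernel q_α, i.e., Σ_{θ∈Θ} π_α(θ) q_α(θ'|θ) = π_α(θ') for all θ' ∈ Θ. -/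
open Matrix Finset

/-- for a log-quadratic energy `U(θ) = θᵀWθ + bᵀθ` (with `∇U(θ) = 2Wθ + b`)
on a finite set `Θ ⊆ ℝ^d`, the DLP kernel `q_α` satisfies detailed balance with respect to
`π_α(θ) ∝ Z_α(θ) e^{U(θ)}`, and consequently `π_α` is a stationary distribution of `q_α`. -/
theorem dlp_reversible_log_quadratic (d : ℕ) (Θ : Finset (Fin d → ℝ)) (hne : Θ.Nonempty)
    (W : Matrix (Fin d) (Fin d) ℝ) (hW : W.IsSymm) (b : Fin d → ℝ)
    (U : (Fin d → ℝ) → ℝ) (hU : ∀ θ, U θ = θ ⬝ᵥ W.mulVec θ + b ⬝ᵥ θ)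
    (α : ℝ) (hα : 0 < α)
    (Zα : (Fin d → ℝ) → ℝ)
    (hZα : ∀ θ, Zα θ = ∑ x ∈ Θ, Real.exp
      ((1 / 2) * (((2 : ℝ) • W.mulVec θ + b) ⬝ᵥ (x - θ))
        - (∑ i, (x i - θ i) ^ 2) / (2 * α)))
    (q : (Fin d → ℝ) → (Fin d → ℝ) → ℝ)
    (hq : ∀ θ θ', q θ θ' = Real.exp
      ((1 / 2) * (((2 : ℝ) • W.mulVec θ + b) ⬝ᵥ (θ' - θ))
        - (∑ i, (θ' i - θ i) ^ 2) / (2 * α)) / Zα θ)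
    (pia : (Fin d → ℝ) → ℝ)
    (hpia : ∀ θ, pia θ = Zα θ * Real.exp (U θ) / ∑ x ∈ Θ, Zα x * Real.exp (U x)) :
    (∀ θ ∈ Θ, ∀ θ' ∈ Θ, pia θ * q θ θ' = pia θ' * q θ' θ) ∧
    (∀ θ' ∈ Θ, ∑ θ ∈ Θ, pia θ * q θ θ' = pia θ') := by
  have hZpos : ∀ θ, 0 < Zα θ := fun θ => by
    rw [hZα]
    exact Finset.sum_pos (fun x _ => Real.exp_pos _) hne
  have hsum : ∀ θ, ∑ x ∈ Θ, q θ x = 1 := fun θ => by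
    simp only [hq]
    rw [← Finset.sum_div, ← hZα, div_self (hZpos θ).ne']
  have hflow : ∀ θ θ', pia θ * q θ θ' =
      Real.exp (W.mulVec θ ⬝ᵥ θ' + (1 / 2) * (b ⬝ᵥ θ + b ⬝ᵥ θ')
        - (∑ i, (θ' i - θ i) ^ 2) / (2 * α)) / ∑ x ∈ Θ, Zα x * Real.exp (U x) := by
    intro θ θ'
    have hexp : W.mulVec θ ⬝ᵥ θ' + (1 / 2) * (b ⬝ᵥ θ + b ⬝ᵥ θ')
        - (∑ i, (θ' i - θ i) ^ 2) / (2 * α)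
        = U θ + ((1 / 2) * (((2 : ℝ) • W.mulVec θ + b) ⬝ᵥ (θ' - θ))
          - (∑ i, (θ' i - θ i) ^ 2) / (2 * α)) := by
      rw [hU, dotProduct_comm θ (W.mulVec θ)]
      simp only [add_dotProduct, smul_dotProduct, dotProduct_sub, smul_eq_mul]
      ring
    have hZ := (hZpos θ).ne'
    rw [hexp, Real.exp_add, hpia, hq]
    field_simp
  have hbal : ∀ θ θ', pia θ * q θ θ' = pia θ' * q θ' θ := by
    intro θ θ'
    have hsymm : W.mulVec θ ⬝ᵥ θ' = W.mulVec θ' ⬝ᵥ θ := by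
      rw [dotProduct_comm, dotProduct_mulVec, ← mulVec_transpose, hW.eq]
    have hdist : ∑ i, (θ' i - θ i) ^ 2 = ∑ i, (θ i - θ' i) ^ 2 :=
      Finset.sum_congr rfl fun i _ => sub_sq_comm _ _
    rw [hflow, hflow, hsymm, hdist, add_comm (b ⬝ᵥ θ)]
  refine ⟨fun θ _ θ' _ => hbal θ θ', fun θ' _ => ?_⟩
  rw [Finset.sum_congr rfl fun θ _ => hbal θ θ', ← Finset.mul_sum, hsum, mul_one]
end

section
/- Let Θ ⊆ ℝ^d be a finite nonempty set, W a symmetric real d×d matrix, b ∈ ℝ^d, U(θ) = θᵀWθ + bᵀθ, π(θ) = e^{U(θ)}/Z with Z = Σ_{x∈Θ} e^{U(x)}, and for α > 0 let Z_α(θ) = Σ_{x∈Θ} exp((1/2)⟨∇U(θ), x−θ⟩ − ‖x−θ‖₂²/(2α)) and π_α(θ) = Z_α(θ) e^{U(θ)} / Σ_{x∈Θ} Z_α(x) e^{U(x)}. Then for every θ ∈ Θ, π_α(θ) → π(θ) as α → 0⁺; hence Σ_{θ∈Θ} |π_α(θ) − π(θ)| → 0 as α → 0⁺. -/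
open Matrix Finset

open Filter Topology

theorem tendsto_exp_sub_div_two_mul_nhdsGT_zero (c : ℝ) {s : ℝ} (hs : 0 < s) :
    Tendsto (fun α : ℝ => Real.exp (c - s / (2 * α))) (𝓝[>] 0) (𝓝 0) := by
  refine Real.tendsto_exp_atBot.comp (tendsto_atBot_add_const_left _ c ?_)
  refine tendsto_neg_atTop_atBot.comp ?_
  refine (tendsto_inv_nhdsGT_zero.const_mul_atTop (half_pos hs)).congr fun α => ?_
  rw [← div_eq_mul_inv, div_div]

/-- A sum of Gaussian weights with exponential tilt concentrates at its center as the variance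
tends to zero. -/
theorem tendsto_sum_exp_dotProduct_sub_sq_div {ι : Type*} [Fintype ι] {Θ : Finset (ι → ℝ)}
    {θ : ι → ℝ} (hθ : θ ∈ Θ) (v : ι → ℝ) :
    Tendsto (fun α : ℝ => ∑ x ∈ Θ, Real.exp
      ((1 / 2) * (v ⬝ᵥ (x - θ)) - (∑ i, (x i - θ i) ^ 2) / (2 * α))) (𝓝[>] 0) (𝓝 1) := by
  classical
  have hsum : ∑ x ∈ Θ, (if x = θ then (1 : ℝ) else 0) = 1 := by simp [hθ]
  rw [← hsum]
  refine tendsto_finsetSum _ fun x _ => ?_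
  split_ifs with hx
  · simp [hx]
  · obtain ⟨i, hi⟩ := Function.ne_iff.mp hx
    exact tendsto_exp_sub_div_two_mul_nhdsGT_zero _ <|
      Finset.sum_pos' (fun _ _ => sq_nonneg _)
        ⟨i, Finset.mem_univ i, sq_pos_of_ne_zero (sub_ne_zero.mpr hi)⟩

/-- for a log-quadratic target `π(θ) = e^{U(θ)}/Z` with
`U(θ) = θᵀWθ + bᵀθ` on a finite set `Θ ⊆ ℝ^d`, the DULA stationary distribution
`π_α(θ) ∝ Z_α(θ)e^{U(θ)}` converges pointwise to `π` as `α → 0⁺`, and hence in `L1`. -/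
theorem dula_stationary_tendsto_target (d : ℕ) (Θ : Finset (Fin d → ℝ)) (hne : Θ.Nonempty)
    (W : Matrix (Fin d) (Fin d) ℝ) (hW : W.IsSymm) (b : Fin d → ℝ)
    (U : (Fin d → ℝ) → ℝ) (hU : ∀ θ, U θ = θ ⬝ᵥ W.mulVec θ + b ⬝ᵥ θ)
    (Z : ℝ) (hZ : Z = ∑ x ∈ Θ, Real.exp (U x))
    (piT : (Fin d → ℝ) → ℝ) (hpiT : ∀ θ, piT θ = Real.exp (U θ) / Z)
    (Zα : ℝ → (Fin d → ℝ) → ℝ)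
    (hZα : ∀ α θ, Zα α θ = ∑ x ∈ Θ, Real.exp
      ((1 / 2) * (((2 : ℝ) • W.mulVec θ + b) ⬝ᵥ (x - θ))
        - (∑ i, (x i - θ i) ^ 2) / (2 * α)))
    (pia : ℝ → (Fin d → ℝ) → ℝ)
    (hpia : ∀ α θ, pia α θ = Zα α θ * Real.exp (U θ) /
      ∑ x ∈ Θ, Zα α x * Real.exp (U x)) :
    (∀ θ ∈ Θ, Filter.Tendsto (fun α : ℝ => pia α θ)
        (nhdsWithin 0 (Set.Ioi 0)) (nhds (piT θ))) ∧
    Filter.Tendsto (fun α : ℝ => ∑ θ ∈ Θ, |pia α θ - piT θ|)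
      (nhdsWithin 0 (Set.Ioi 0)) (nhds 0) := by
  have hZlim : ∀ θ ∈ Θ, Tendsto (fun α => Zα α θ) (𝓝[>] 0) (𝓝 1) := fun θ hθ => by
    simpa only [hZα] using tendsto_sum_exp_dotProduct_sub_sq_div hθ _
  have hw : ∀ θ ∈ Θ, Tendsto (fun α => Zα α θ * Real.exp (U θ)) (𝓝[>] 0)
      (𝓝 (Real.exp (U θ))) := fun θ hθ => by
    simpa using (hZlim θ hθ).mul_const (Real.exp (U θ))
  have hZne : Z ≠ 0 := hZ ▸ (Finset.sum_pos (fun x _ => Real.exp_pos (U x)) hne).ne'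
  have hden : Tendsto (fun α => ∑ x ∈ Θ, Zα α x * Real.exp (U x)) (𝓝[>] 0) (𝓝 Z) :=
    hZ ▸ tendsto_finsetSum _ hw
  have hpi : ∀ θ ∈ Θ, Tendsto (fun α => pia α θ) (𝓝[>] 0) (𝓝 (piT θ)) := fun θ hθ => by
    simp only [hpia, hpiT]
    exact (hw θ hθ).div hden hZne
  refine ⟨hpi, ?_⟩
  have hL1 := tendsto_finsetSum Θ fun θ hθ => ((hpi θ hθ).sub_const (piT θ)).abs
  simpa using hL1
end

section
/- Let Θ be a finite nonempty set, δ ≥ 0, and U, V : Θ → ℝ with |U(θ) − V(θ)| ≤ δ for all θ ∈ Θ. Define π(θ) = e^{U(θ)} / Σ_{x∈Θ} e^{U(x)} and π'(θ) = e^{V(θ)} / Σ_{x∈Θ} e^{V(x)}. Then Σ_{θ∈Θ} |π(θ) − π'(θ)| ≤ 2(e^{2δ} − 1). -/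
open Finset

/-- Energies within `δ` of each other have Gibbs weights within a factor `e^{2δ}`. -/
theorem gibbs_weight_le_exp_mul {Θ : Type*} [Fintype Θ] [Nonempty Θ]
    {δ : ℝ} {U V : Θ → ℝ} (h : ∀ θ, |U θ - V θ| ≤ δ) (θ : Θ) :
    Real.exp (U θ) / (∑ x, Real.exp (U x))
      ≤ Real.exp (2 * δ) * (Real.exp (V θ) / (∑ x, Real.exp (V x))) := by
  have hU : 0 < ∑ x, Real.exp (U x) := sum_pos (fun x _ => Real.exp_pos _) univ_nonempty
  have hV : 0 < ∑ x, Real.exp (V x) := sum_pos (fun x _ => Real.exp_pos _) univ_nonempty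
  have hweight : Real.exp (U θ) ≤ Real.exp δ * Real.exp (V θ) := by
    rw [← Real.exp_add, Real.exp_le_exp]
    linarith [(abs_le.mp (h θ)).2]
  have hsum : ∑ x, Real.exp (V x) ≤ Real.exp δ * ∑ x, Real.exp (U x) := by
    rw [mul_sum]
    refine sum_le_sum fun x _ => ?_
    rw [← Real.exp_add, Real.exp_le_exp]
    linarith [(abs_le.mp (h x)).1]
  rw [← mul_div_assoc, div_le_div_iff₀ hU hV]
  calc Real.exp (U θ) * ∑ x, Real.exp (V x)
      ≤ (Real.exp δ * Real.exp (V θ)) * (Real.exp δ * ∑ x, Real.exp (U x)) := by gcongr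
    _ = Real.exp (2 * δ) * Real.exp (V θ) * ∑ x, Real.exp (U x) := by
      rw [two_mul, Real.exp_add]
      ring

/-- if two energies on a finite nonempty set differ pointwise by at most `δ`,
then the `L1` distance between the corresponding Gibbs distributions is at most
`2(e^{2δ} - 1)`. -/
theorem gibbs_l1_perturbation (Θ : Type*) [Fintype Θ] [Nonempty Θ]
    (δ : ℝ) (hδ : 0 ≤ δ) (U V : Θ → ℝ) (h : ∀ θ, |U θ - V θ| ≤ δ) :
    ∑ θ, |Real.exp (U θ) / (∑ x, Real.exp (U x))
        - Real.exp (V θ) / (∑ x, Real.exp (V x))|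
      ≤ 2 * (Real.exp (2 * δ) - 1) := by
  have hE : 1 ≤ Real.exp (2 * δ) := Real.one_le_exp (by positivity)
  have hV : 0 < ∑ x, Real.exp (V x) := sum_pos (fun x _ => Real.exp_pos _) univ_nonempty
  have hterm : ∀ θ, |Real.exp (U θ) / (∑ x, Real.exp (U x))
      - Real.exp (V θ) / (∑ x, Real.exp (V x))|
      ≤ (Real.exp (2 * δ) - 1) * (Real.exp (V θ) / (∑ x, Real.exp (V x))) := by
    intro θ
    have hUV := gibbs_weight_le_exp_mul h θ
    have hVU := gibbs_weight_le_exp_mul (fun x => (abs_sub_comm (V x) (U x)).trans_le (h x)) θ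
    rw [abs_le]
    constructor
    · rcases le_total (Real.exp (U θ) / (∑ x, Real.exp (U x)))
        (Real.exp (V θ) / (∑ x, Real.exp (V x))) with hle | hle
      · linarith [mul_le_mul_of_nonneg_left hle (sub_nonneg.mpr hE)]
      · have : 0 ≤ (Real.exp (2 * δ) - 1) * (Real.exp (V θ) / (∑ x, Real.exp (V x))) :=
          mul_nonneg (sub_nonneg.mpr hE) (by positivity)
        linarith
    · linarith
  calc _ ≤ ∑ θ, (Real.exp (2 * δ) - 1) * (Real.exp (V θ) / (∑ x, Real.exp (V x))) :=
        sum_le_sum fun θ _ => hterm θ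
    _ = Real.exp (2 * δ) - 1 := by rw [← mul_sum, ← sum_div, div_self hV.ne', mul_one]
    _ ≤ 2 * (Real.exp (2 * δ) - 1) := by linarith
end

section
/- Let Θ be a finite nonempty set, δ ≥ 0, and w, v : Θ → ℝ strictly positive functions such that e^{−δ} ≤ w(θ)/v(θ) ≤ e^{δ} for all θ ∈ Θ. Let W = Σ_{x∈Θ} w(x) and V = Σ_{x∈Θ} v(x). Then for every θ ∈ Θ, | w(θ)/W − v(θ)/V | ≤ (e^{2δ} − 1) ( w(θ)/W + v(θ)/V ). -/
open Finset

theorem div_sum_le_sq_mul_div_sum {ι : Type*} [Fintype ι] [Nonempty ι] {c : ℝ} {f g : ι → ℝ}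
    (hf : ∀ i, 0 < f i) (hg : ∀ i, 0 < g i) (hfg : ∀ i, f i ≤ c * g i)
    (hgf : ∀ i, g i ≤ c * f i) (i : ι) :
    f i / ∑ j, f j ≤ c ^ 2 * (g i / ∑ j, g j) := by
  have hF : 0 < ∑ j, f j := sum_pos (fun j _ => hf j) univ_nonempty
  have hG : 0 < ∑ j, g j := sum_pos (fun j _ => hg j) univ_nonempty
  have hGF : ∑ j, g j ≤ c * ∑ j, f j := by
    rw [mul_sum]
    exact sum_le_sum fun j _ => hgf j
  rw [← mul_div_assoc, div_le_div_iff₀ hF hG]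
  calc f i * ∑ j, g j ≤ (c * g i) * (c * ∑ j, f j) :=
        mul_le_mul (hfg i) hGF hG.le ((hf i).le.trans (hfg i))
    _ = c ^ 2 * g i * ∑ j, f j := by ring

/-- pointwise perturbation bound for normalized positive weight functions:
if `e^{-δ} ≤ w(θ)/v(θ) ≤ e^{δ}` for all `θ`, then
`|w(θ)/W - v(θ)/V| ≤ (e^{2δ} - 1)(w(θ)/W + v(θ)/V)` where `W, V` are the total weights. -/
theorem normalized_weights_pointwise_perturbation (Θ : Type*) [Fintype Θ] [Nonempty Θ]
    (δ : ℝ) (hδ : 0 ≤ δ) (w v : Θ → ℝ)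
    (hw : ∀ θ, 0 < w θ) (hv : ∀ θ, 0 < v θ)
    (hratio : ∀ θ, Real.exp (-δ) ≤ w θ / v θ ∧ w θ / v θ ≤ Real.exp δ) :
    ∀ θ, |w θ / (∑ x, w x) - v θ / (∑ x, v x)|
      ≤ (Real.exp (2 * δ) - 1) * (w θ / (∑ x, w x) + v θ / (∑ x, v x)) := by
  intro θ
  have hwv : ∀ x, w x ≤ Real.exp δ * v x := fun x => (div_le_iff₀ (hv x)).1 (hratio x).2
  have hvw : ∀ x, v x ≤ Real.exp δ * w x := fun x => by
    have h := (le_div_iff₀ (hv x)).1 (hratio x).1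
    rwa [Real.exp_neg, inv_mul_le_iff₀ (Real.exp_pos δ)] at h
  have hp := div_sum_le_sq_mul_div_sum hw hv hwv hvw θ
  have hq := div_sum_le_sq_mul_div_sum hv hw hvw hwv θ
  have hexp : Real.exp (2 * δ) = Real.exp δ ^ 2 := by
    rw [sq, ← Real.exp_add, two_mul]
  rw [← hexp] at hp hq
  have hone : 0 ≤ Real.exp (2 * δ) - 1 := sub_nonneg.2 (Real.one_le_exp (by positivity))
  have hp0 : 0 ≤ w θ / ∑ x, w x := div_nonneg (hw θ).le (sum_nonneg fun x _ => (hw x).le)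
  have hq0 : 0 ≤ v θ / ∑ x, v x := div_nonneg (hv θ).le (sum_nonneg fun x _ => (hv x).le)
  have hp1 := mul_nonneg hone hp0
  have hq1 := mul_nonneg hone hq0
  rw [abs_le]
  constructor <;> linarith
end

section
/- Let Θ ⊆ ℝ^d be a finite nonempty set with D = max_{θ,θ'∈Θ} ‖θ'−θ‖_∞, let U, V : ℝ^d → ℝ be differentiable, α > 0, and ε ≥ 0 such that ‖∇U(θ) − ∇V(θ)‖₁ ≤ ε for all θ ∈ Θ. Let q^U_α and q^V_α be the DLP kernels for U and V respectively: q^U_α(θ'|θ) = exp((1/2)⟨∇U(θ), θ'−θ⟩ − ‖θ'−θ‖₂²/(2α)) / Σ_{x∈Θ} exp((1/2)⟨∇U(θ), x−θ⟩ − ‖x−θ‖₂²/(2α)), and similarly for V. Then for every θ ∈ Θ, Σ_{θ'∈Θ} | q^U_α(θ'|θ) − q^V_α(θ'|θ) | ≤ 2( e^{Dε} − 1 ). -/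
open Matrix Finset

/-- If two exponents differ by at most `δ` on `s`, the softmax weights of the first are at most
`exp (2 * δ)` times those of the second. -/
theorem softmax_le_exp_mul_softmax {ι : Type*} {s : Finset ι} {f g : ι → ℝ} {δ : ℝ}
    (h : ∀ x ∈ s, |f x - g x| ≤ δ) {x : ι} (hx : x ∈ s) :
    Real.exp (f x) / ∑ y ∈ s, Real.exp (f y) ≤
      Real.exp (2 * δ) * (Real.exp (g x) / ∑ y ∈ s, Real.exp (g y)) := by
  have hpos (k : ι → ℝ) : 0 < ∑ y ∈ s, Real.exp (k y) :=
    Finset.sum_pos (fun y _ => Real.exp_pos _) ⟨x, hx⟩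
  have hnum : Real.exp (f x) ≤ Real.exp δ * Real.exp (g x) := by
    rw [← Real.exp_add]
    exact Real.exp_le_exp.2 (by linarith [(abs_le.1 (h x hx)).2])
  have hden : ∑ y ∈ s, Real.exp (g y) ≤ Real.exp δ * ∑ y ∈ s, Real.exp (f y) := by
    rw [Finset.mul_sum]
    refine Finset.sum_le_sum fun y hy => ?_
    rw [← Real.exp_add]
    exact Real.exp_le_exp.2 (by linarith [(abs_le.1 (h y hy)).1])
  rw [← mul_div_assoc, div_le_div_iff₀ (hpos f) (hpos g), two_mul, Real.exp_add]
  calc Real.exp (f x) * ∑ y ∈ s, Real.exp (g y)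
      ≤ (Real.exp δ * Real.exp (g x)) * (Real.exp δ * ∑ y ∈ s, Real.exp (f y)) :=
        mul_le_mul hnum hden (hpos g).le (by positivity)
    _ = _ := by ring

/-- The `L1` distance between two softmax distributions whose exponents differ by at most `δ`. -/
theorem sum_abs_softmax_sub_le {ι : Type*} {s : Finset ι} (hs : s.Nonempty) {f g : ι → ℝ} {δ : ℝ}
    (h : ∀ x ∈ s, |f x - g x| ≤ δ) :
    ∑ x ∈ s, |Real.exp (f x) / (∑ y ∈ s, Real.exp (f y)) -
        Real.exp (g x) / (∑ y ∈ s, Real.exp (g y))| ≤ 2 * (Real.exp (2 * δ) - 1) := by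
  have hsum (k : ι → ℝ) : ∑ x ∈ s, Real.exp (k x) / (∑ y ∈ s, Real.exp (k y)) = 1 := by
    rw [← Finset.sum_div]
    exact div_self (Finset.sum_pos (fun y _ => Real.exp_pos _) hs).ne'
  have hδ : 0 ≤ δ := let ⟨x, hx⟩ := hs; (abs_nonneg _).trans (h x hx)
  have hexp : 0 ≤ Real.exp (2 * δ) - 1 := sub_nonneg.2 (Real.one_le_exp (by positivity))
  calc _ ≤ ∑ x ∈ s, (Real.exp (2 * δ) - 1) * (Real.exp (f x) / (∑ y ∈ s, Real.exp (f y)) +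
          Real.exp (g x) / (∑ y ∈ s, Real.exp (g y))) := by
        refine Finset.sum_le_sum fun x hx => ?_
        have hfg := softmax_le_exp_mul_softmax h hx
        have hgf := softmax_le_exp_mul_softmax (f := g) (g := f)
          (fun y hy => by rw [abs_sub_comm]; exact h y hy) hx
        have hnonneg (k : ι → ℝ) :
            0 ≤ (Real.exp (2 * δ) - 1) * (Real.exp (k x) / ∑ y ∈ s, Real.exp (k y)) :=
          mul_nonneg hexp (by positivity)
        rw [abs_le]
        constructor <;> linarith [hnonneg f, hnonneg g]
    _ = 2 * (Real.exp (2 * δ) - 1) := by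
        rw [← Finset.mul_sum, Finset.sum_add_distrib, hsum f, hsum g]
        ring

/-- Hölder's inequality for the dot product, between the `ℓ1` and the sup norm. -/
theorem abs_dotProduct_le_sum_abs_mul_norm {ι : Type*} [Fintype ι] (v w : ι → ℝ) :
    |v ⬝ᵥ w| ≤ (∑ i, |v i|) * ‖w‖ := by
  rw [Finset.sum_mul]
  refine (Finset.abs_sum_le_sum_abs _ _).trans (Finset.sum_le_sum fun i _ => ?_)
  rw [abs_mul]
  exact mul_le_mul_of_nonneg_left (norm_le_pi_norm w i) (abs_nonneg _)

/-- row-wise `L1` bound between the DLP kernels of two differentiable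
energies `U, V` whose gradients are `ε`-close in `ℓ1` norm on `Θ`:
`Σ_{θ'} |q^U_α(θ'|θ) - q^V_α(θ'|θ)| ≤ 2(e^{Dε} - 1)` where
`D = max_{θ,θ'∈Θ} ‖θ'-θ‖_∞` (the `ℓ∞` norm is the sup norm on `Fin d → ℝ`). -/
theorem dlp_kernel_rowwise_l1_bound (d : ℕ) (Θ : Finset (Fin d → ℝ)) (hne : Θ.Nonempty)
    (D : ℝ) (hD : IsGreatest {r : ℝ | ∃ θ ∈ Θ, ∃ θ' ∈ Θ, r = ‖θ' - θ‖} D)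
    (U V : (Fin d → ℝ) → ℝ) (gradU gradV : (Fin d → ℝ) → (Fin d → ℝ))
    (hUdiff : Differentiable ℝ U) (hVdiff : Differentiable ℝ V)
    (hgU : ∀ θ (w : Fin d → ℝ), fderiv ℝ U θ w = gradU θ ⬝ᵥ w)
    (hgV : ∀ θ (w : Fin d → ℝ), fderiv ℝ V θ w = gradV θ ⬝ᵥ w)
    (α : ℝ) (hα : 0 < α) (ε : ℝ) (hε : 0 ≤ ε)
    (hgrad : ∀ θ ∈ Θ, ∑ i, |gradU θ i - gradV θ i| ≤ ε)
    (θ : Fin d → ℝ) (hθ : θ ∈ Θ) :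
    ∑ θ' ∈ Θ,
      |Real.exp ((1 / 2) * (gradU θ ⬝ᵥ (θ' - θ)) - (∑ i, (θ' i - θ i) ^ 2) / (2 * α)) /
          (∑ x ∈ Θ, Real.exp
            ((1 / 2) * (gradU θ ⬝ᵥ (x - θ)) - (∑ i, (x i - θ i) ^ 2) / (2 * α)))
        - Real.exp ((1 / 2) * (gradV θ ⬝ᵥ (θ' - θ)) - (∑ i, (θ' i - θ i) ^ 2) / (2 * α)) /
          (∑ x ∈ Θ, Real.exp
            ((1 / 2) * (gradV θ ⬝ᵥ (x - θ)) - (∑ i, (x i - θ i) ^ 2) / (2 * α)))|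
      ≤ 2 * (Real.exp (D * ε) - 1) := by
  have hexponent : ∀ x ∈ Θ,
      |((1 / 2) * (gradU θ ⬝ᵥ (x - θ)) - (∑ i, (x i - θ i) ^ 2) / (2 * α)) -
        ((1 / 2) * (gradV θ ⬝ᵥ (x - θ)) - (∑ i, (x i - θ i) ^ 2) / (2 * α))| ≤ D * ε / 2 := by
    intro x hx
    have hbound : |(gradU θ - gradV θ) ⬝ᵥ (x - θ)| ≤ ε * D :=
      (abs_dotProduct_le_sum_abs_mul_norm _ _).trans
        (mul_le_mul (hgrad θ hθ) (hD.2 ⟨θ, hθ, x, hx, rfl⟩) (norm_nonneg _) hε)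
    rw [sub_dotProduct, abs_le] at hbound
    rw [abs_le]
    constructor <;> linarith [hbound.1, hbound.2]
  have h := sum_abs_softmax_sub_le hne hexponent
  rwa [mul_div_cancel₀ (D * ε) two_ne_zero] at h
end

section
/- Fix α > 0, L ≥ 0, σ ≥ 0, and t ∈ {0,1}. For h ∈ ℝ, define the probability distribution q_t(·; h) on {0,1} by q_t(s; h) = exp((1/2)h(s−t) − (s−t)²/(2α)) / Σ_{s'∈{0,1}} exp((1/2)h(s'−t) − (s'−t)²/(2α)). Let G be a real-valued random variable with E[G] = g, Var(G) ≤ σ², |G| ≤ L almost surely, and |g| ≤ L. Then Σ_{s∈{0,1}} | E[ q_t(s; G) ] − q_t(s; g) | ≤ 2σ · exp( −1/(2α) + L ). -/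
open Finset MeasureTheory

/-- The exponential is `exp M`-Lipschitz on `(-∞, M]`. -/
lemma abs_exp_sub_exp_le {a b M : ℝ} (ha : a ≤ M) (hb : b ≤ M) :
    |Real.exp a - Real.exp b| ≤ Real.exp M * |a - b| := by
  wlog hab : b ≤ a generalizing a b
  · rw [abs_sub_comm, abs_sub_comm a]
    exact this hb ha (le_of_not_ge hab)
  rw [abs_of_nonneg (sub_nonneg.2 (Real.exp_le_exp.2 hab)), abs_of_nonneg (sub_nonneg.2 hab)]
  have h : Real.exp b = Real.exp a * Real.exp (b - a) := by rw [← Real.exp_add]; ring_nf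
  calc Real.exp a - Real.exp b = Real.exp a * (1 - Real.exp (b - a)) := by rw [h]; ring
    _ ≤ Real.exp a * (a - b) := by
        refine mul_le_mul_of_nonneg_left ?_ (Real.exp_nonneg a)
        linarith [Real.add_one_le_exp (b - a)]
    _ ≤ Real.exp M * (a - b) := by
        have := sub_nonneg.2 hab
        gcongr

lemma abs_inv_one_add_sub_inv_one_add_le {x y : ℝ} (hx : 0 ≤ x) (hy : 0 ≤ y) :
    |1 / (1 + x) - 1 / (1 + y)| ≤ |x - y| := by
  have hxy : 1 / (1 + x) - 1 / (1 + y) = (y - x) / ((1 + x) * (1 + y)) := by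
    field_simp
    ring
  rw [hxy, abs_div, abs_sub_comm y x, abs_of_pos (by positivity : 0 < (1 + x) * (1 + y))]
  exact div_le_self (abs_nonneg _) (by nlinarith [mul_nonneg hx hy])

lemma abs_div_one_add_sub_div_one_add_le {x y : ℝ} (hx : 0 ≤ x) (hy : 0 ≤ y) :
    |x / (1 + x) - y / (1 + y)| ≤ |x - y| := by
  have hxy : x / (1 + x) - y / (1 + y) = 1 / (1 + y) - 1 / (1 + x) := by
    field_simp
    ring
  rw [hxy, abs_sub_comm x y]
  exact abs_inv_one_add_sub_inv_one_add_le hy hx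

/-- The tilted weight `h ↦ exp (c * h - b)`, with `|c| ≤ 1`, is Lipschitz on `[-L, L]`. -/
lemma abs_exp_mul_sub_exp_mul_le {b c x y L : ℝ} (hc : |c| ≤ 1) (hx : |x| ≤ L) (hy : |y| ≤ L) :
    |Real.exp (c * x - b) - Real.exp (c * y - b)| ≤ Real.exp (-b + L) * |x - y| := by
  have bound : ∀ z, |z| ≤ L → c * z - b ≤ -b + L := fun z hz => by
    have h₁ := le_abs_self (c * z)
    rw [abs_mul] at h₁
    have h₂ := mul_le_of_le_one_left (abs_nonneg z) hc
    linarith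
  refine (abs_exp_sub_exp_le (bound x hx) (bound y hy)).trans ?_
  have h : c * x - b - (c * y - b) = c * (x - y) := by ring
  rw [h, abs_mul]
  gcongr
  exact mul_le_of_le_one_left (abs_nonneg _) hc

/-- The mean absolute deviation is bounded by the standard deviation. -/
lemma integral_abs_sub_le_of_integral_sq_le {Ω : Type*} [MeasurableSpace Ω] {μ : Measure Ω}
    [IsProbabilityMeasure μ] {X : Ω → ℝ} {σ : ℝ} (hσ : 0 ≤ σ) (hX : MemLp X 2 μ)
    (hvar : ∫ ω, X ω ^ 2 ∂μ ≤ σ ^ 2) : ∫ ω, |X ω| ∂μ ≤ σ := by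
  have h₁ := ProbabilityTheory.variance_eq_sub hX.abs
  have h₂ := ProbabilityTheory.variance_nonneg |X| μ
  simp only [Pi.pow_apply, Pi.abs_apply, sq_abs] at h₁
  exact abs_le_of_sq_le_sq' (by linarith) hσ |>.2

/-- Replacing a bounded random variable by a point `g` changes the mean of a function that is
`K`-Lipschitz at `g` by at most `K` times the root mean square deviation from `g`. -/
lemma abs_integral_comp_sub_le {Ω : Type*} [MeasurableSpace Ω] {μ : Measure Ω}
    [IsProbabilityMeasure μ] {G : Ω → ℝ} {g L σ K : ℝ} (hσ : 0 ≤ σ) (hG : Measurable G)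
    (hvar : ∫ ω, (G ω - g) ^ 2 ∂μ ≤ σ ^ 2) (hbound : ∀ᵐ ω ∂μ, |G ω| ≤ L) {F : ℝ → ℝ}
    (hF : Measurable F) (hK : 0 ≤ K) (hlip : ∀ x, |x| ≤ L → |F x - F g| ≤ K * |x - g|) :
    |(∫ ω, F (G ω) ∂μ) - F g| ≤ σ * K := by
  have hX : MemLp (fun ω => G ω - g) 2 μ :=
    (MemLp.of_bound hG.aestronglyMeasurable L hbound).sub (memLp_const g)
  have hXi : Integrable (fun ω => K * |G ω - g|) μ :=
    ((hX.integrable (by norm_num)).abs).const_mul K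
  have hle : ∀ᵐ ω ∂μ, ‖F (G ω) - F g‖ ≤ K * |G ω - g| := by
    filter_upwards [hbound] with ω hω using hlip _ hω
  have hD : Integrable (fun ω => F (G ω) - F g) μ :=
    hXi.mono' ((hF.comp hG).sub_const _).aestronglyMeasurable hle
  have hFi : Integrable (fun ω => F (G ω)) μ :=
    (hD.add (integrable_const (F g))).congr (.of_forall fun ω => by simp)
  have heq : (∫ ω, F (G ω) ∂μ) - F g = ∫ ω, (F (G ω) - F g) ∂μ := by
    rw [integral_sub hFi (integrable_const _)]
    simp
  calc |(∫ ω, F (G ω) ∂μ) - F g| ≤ ∫ ω, K * |G ω - g| ∂μ := by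
        rw [heq]
        exact norm_integral_le_of_norm_le hXi hle
    _ = (∫ ω, |G ω - g| ∂μ) * K := by rw [integral_const_mul, mul_comm]
    _ ≤ σ * K := by
        gcongr
        exact integral_abs_sub_le_of_integral_sq_le hσ hX hvar

/-- Theorem 3 of the paper: for a single binary coordinate with current
value `t ∈ {0,1}`, stepsize `α > 0`, and a stochastic gradient `G` with mean `g`,
variance at most `σ²`, and `|G| ≤ L` a.s., `|g| ≤ L`, the `L1` distance between the
expected stochastic-gradient DLP and the full-batch DLP is at most
`2σ·exp(-1/(2α) + L)`. -/
theorem stochastic_dlp_bias {Ω : Type*} [MeasurableSpace Ω] (μ : Measure Ω)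
    [IsProbabilityMeasure μ] (α L σ t : ℝ) (hα : 0 < α) (hL : 0 ≤ L) (hσ : 0 ≤ σ)
    (ht : t = 0 ∨ t = 1) (G : Ω → ℝ) (hGmeas : Measurable G) (g : ℝ)
    (hmean : ∫ ω, G ω ∂μ = g)
    (hvar : ∫ ω, (G ω - g) ^ 2 ∂μ ≤ σ ^ 2)
    (hbound : ∀ᵐ ω ∂μ, |G ω| ≤ L) (hg : |g| ≤ L) :
    ∑ s ∈ ({0, 1} : Finset ℝ),
      |(∫ ω, (Real.exp ((1 / 2) * G ω * (s - t) - (s - t) ^ 2 / (2 * α)) /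
          ∑ s' ∈ ({0, 1} : Finset ℝ),
            Real.exp ((1 / 2) * G ω * (s' - t) - (s' - t) ^ 2 / (2 * α))) ∂μ)
        - Real.exp ((1 / 2) * g * (s - t) - (s - t) ^ 2 / (2 * α)) /
          ∑ s' ∈ ({0, 1} : Finset ℝ),
            Real.exp ((1 / 2) * g * (s' - t) - (s' - t) ^ 2 / (2 * α))|
      ≤ 2 * σ * Real.exp (-1 / (2 * α) + L) := by
  have hb : -1 / (2 * α) = -(1 / (2 * α)) := by ring
  have key : ∀ s ∈ ({0, 1} : Finset ℝ), _ ≤ σ * Real.exp (-1 / (2 * α) + L) := fun s hs =>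
    abs_integral_comp_sub_le hσ hGmeas hvar hbound
      (F := fun h => Real.exp ((1 / 2) * h * (s - t) - (s - t) ^ 2 / (2 * α)) /
          ∑ s' ∈ ({0, 1} : Finset ℝ),
            Real.exp ((1 / 2) * h * (s' - t) - (s' - t) ^ 2 / (2 * α)))
      (by fun_prop) (Real.exp_nonneg _) fun x hx => by
        have up := abs_exp_mul_sub_exp_mul_le (b := 1 / (2 * α)) (c := 1 / 2)
          (by norm_num [abs_of_pos]) hx hg
        have down := abs_exp_mul_sub_exp_mul_le (b := 1 / (2 * α)) (c := -(1 / 2))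
          (by norm_num [abs_of_pos]) hx hg
        have e₀ (h : ℝ) : 1 / 2 * h * (0 - 1) - (0 - 1) ^ 2 / (2 * α)
            = -(1 / 2) * h - 1 / (2 * α) := by ring
        have e₁ (h : ℝ) : 1 / 2 * h * (1 - 0) - (1 - 0) ^ 2 / (2 * α)
            = 1 / 2 * h - 1 / (2 * α) := by ring
        have e₂ (h c : ℝ) : 1 / 2 * h * (c - c) - (c - c) ^ 2 / (2 * α) = 0 := by ring
        rw [hb]
        simp only [Finset.mem_insert, Finset.mem_singleton] at hs
        simp only [Finset.sum_pair (zero_ne_one' ℝ)]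
        rcases ht with rfl | rfl <;> rcases hs with rfl | rfl <;>
          simp only [e₀, e₁, e₂, Real.exp_zero]
        · exact (abs_inv_one_add_sub_inv_one_add_le (Real.exp_nonneg _)
            (Real.exp_nonneg _)).trans up
        · exact (abs_div_one_add_sub_div_one_add_le (Real.exp_nonneg _)
            (Real.exp_nonneg _)).trans up
        · rw [add_comm _ (1 : ℝ), add_comm _ (1 : ℝ)]
          exact (abs_div_one_add_sub_div_one_add_le (Real.exp_nonneg _)
            (Real.exp_nonneg _)).trans down
        · rw [add_comm _ (1 : ℝ), add_comm _ (1 : ℝ)]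
          exact (abs_inv_one_add_sub_inv_one_add_le (Real.exp_nonneg _)
            (Real.exp_nonneg _)).trans down
  refine (Finset.sum_le_sum key).trans_eq ?_
  rw [Finset.sum_pair (zero_ne_one' ℝ)]
  ring
end
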